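/- Let G be a countable discrete amenable group, (V,‖·‖) a semi-normed real vector space, π: G → Isom(V) a uniformly bounded representation, W ⊆ V a subset, and U a subspace with L_W ⊆ U ⊆ cl(L). Then the map θ(w + U) = w + cl(L) is a well-defined linear isomorphism between the subspace {w + U : w ∈ cl(span W)} of V/U with the quotient semi-norm ‖·‖_U and the subspace {w + cl(L) : w ∈ cl(span W)} of V/cl(L) with the quotient norm ‖·‖_{cl(L)}. If in addition π is isometric (C_π = 1), then θ is an isometry. -/

import Mathlib

open scoped Pointwise
open Filter

/-- The collection `F(G)` of non-empty finite subsets of `G`. -/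
def FinG (G : Type*) := {F : Finset G // F.Nonempty}

section Defs

variable {G : Type*} [Group G] [DecidableEq G]

/-- `F` is `(K, δ)`-invariant: `|KF Δ F| ≤ δ|F|`. -/
def IsInv (K : Finset G) (δ : ℝ) (F : Finset G) : Prop :=
  ((symmDiff (K * F) F).card : ℝ) ≤ δ * (F.card : ℝ)

/-- `G` is amenable: for every `(K, δ)` there is a `(K, δ)`-invariant nonempty finite set. -/
def AmenableG (G : Type*) [Group G] [DecidableEq G] : Prop :=
  ∀ K : Finset G, K.Nonempty → ∀ δ : ℝ, 0 < δ →
    ∃ F : Finset G, F.Nonempty ∧ IsInv K δ F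

/-- `limsup_{F → G} φ(F) = inf_{(K,δ)} sup {φ(F) : F is (K,δ)-invariant}` (in the extended reals). -/
noncomputable def limsupG (φ : FinG G → ℝ) : EReal :=
  ⨅ (K : {K : Finset G // K.Nonempty}) (δ : {d : ℝ // 0 < d}),
    ⨆ F : {F : FinG G // IsInv K.1 δ.1 F.1}, (φ F.1 : EReal)

/-- `liminf_{F → G} φ(F) = sup_{(K,δ)} inf {φ(F) : F is (K,δ)-invariant}` (in the extended reals). -/
noncomputable def liminfG (φ : FinG G → ℝ) : EReal :=
  ⨆ (K : {K : Finset G // K.Nonempty}) (δ : {d : ℝ // 0 < d}),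
    ⨅ F : {F : FinG G // IsInv K.1 δ.1 F.1}, (φ F.1 : EReal)

/-- `lim_{F → G} φ(F) = L`. -/
def TendstoG (φ : FinG G → ℝ) (L : ℝ) : Prop :=
  ∀ ε : ℝ, 0 < ε → ∃ (K : Finset G) (δ : ℝ), K.Nonempty ∧ 0 < δ ∧
    ∀ F : FinG G, IsInv K δ F.1 → |φ F - L| < ε

/-- A (left) Følner sequence: `|F_n Δ g F_n| / |F_n| → 0` for every `g ∈ G`. -/
def FolnerSeq (F : ℕ → FinG G) : Prop :=
  ∀ g : G, Filter.Tendsto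
    (fun n => ((symmDiff ((F n).1.image (fun h => g * h)) (F n).1).card : ℝ) / ((F n).1.card : ℝ))
    Filter.atTop (nhds (0 : ℝ))

variable {V : Type*} [SeminormedAddCommGroup V] [NormedSpace ℝ V]

/-- The representation `π` is uniformly bounded with constant `C`. -/
def UnifBdd (π : G →* (V ≃L[ℝ] V)) (C : ℝ) : Prop :=
  ∀ (g : G) (v : V), ‖π g v‖ ≤ C * ‖v‖

/-- The representation `π` is isometric (`C_π = 1`). -/
def IsIsometric (π : G →* (V ≃L[ℝ] V)) : Prop :=
  ∀ (g : G) (v : V), ‖π g v‖ = ‖v‖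

/-- The ergodic sum `S_F v = Σ_{g ∈ F} π(g⁻¹) v`. -/
noncomputable def SF (π : G →* (V ≃L[ℝ] V)) (F : Finset G) (v : V) : V :=
  ∑ g ∈ F, π g⁻¹ v

/-- The ergodic average `A_F v = |F|⁻¹ • S_F v`. -/
noncomputable def AF (π : G →* (V ≃L[ℝ] V)) (F : Finset G) (v : V) : V :=
  (F.card : ℝ)⁻¹ • SF π F v

/-- Right translation `g • F = F g⁻¹` on nonempty finite subsets. -/
def rT (g : G) (F : FinG G) : FinG G :=
  ⟨F.1.image (fun h => h * g⁻¹), F.2.image (fun h => h * g⁻¹)⟩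

/-- `G`-equivariance of a set map: `π(g) φ(F) = φ(F g⁻¹)`. -/
def IsEquivariant (π : G →* (V ≃L[ℝ] V)) (φ : FinG G → V) : Prop :=
  ∀ (g : G) (F : FinG G), π g (φ F) = φ (rT g F)

/-- Boundedness of a set map: `sup_F ‖φ(F)‖/|F| < ∞`. -/
def IsBddMap (φ : FinG G → V) : Prop :=
  ∃ C : ℝ, ∀ F : FinG G, ‖φ F‖ ≤ C * (F.1.card : ℝ)

/-- Membership in the space `M` of bounded `G`-equivariant set maps. -/
def MemM (π : G →* (V ≃L[ℝ] V)) (φ : FinG G → V) : Prop :=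
  IsBddMap φ ∧ IsEquivariant π φ

/-- The sup seminorm `|||φ|||_sup = sup_F ‖φ(F)‖/|F|`. -/
noncomputable def supNorm (φ : FinG G → V) : ℝ :=
  ⨆ F : FinG G, ‖φ F‖ / (F.1.card : ℝ)

/-- The asymptotic seminorm `|||φ|||_G = limsup_{F → G} ‖φ(F)‖/|F|` (in the extended reals). -/
noncomputable def normG (φ : FinG G → V) : EReal :=
  limsupG (fun F => ‖φ F‖ / (F.1.card : ℝ))

/-- Union of nonempty finite subsets. -/
def unionF (E F : FinG G) : FinG G :=
  ⟨E.1 ∪ F.1, E.2.inl⟩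

/-- Additive set maps: `φ(E ⊔ F) = φ(E) + φ(F)` for disjoint `E, F`. -/
def IsAdditiveMap (φ : FinG G → V) : Prop :=
  ∀ E F : FinG G, Disjoint E.1 F.1 → φ (unionF E F) = φ E + φ F

/-- The additive set map `S(v)(F) = S_F v`. -/
noncomputable def Smap (π : G →* (V ≃L[ℝ] V)) (v : V) : FinG G → V :=
  fun F => SF π F.1 v

/-- The coboundary subspace `L_W = span{w − π(g)w : w ∈ W, g ∈ G}`. -/
def cobSpan (π : G →* (V ≃L[ℝ] V)) (W : Set V) : Submodule ℝ V :=
  Submodule.span ℝ {x | ∃ w ∈ W, ∃ g : G, x = w - π g w}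

/-- The coboundary subspace `L = L_V`. -/
def cobL (π : G →* (V ≃L[ℝ] V)) : Submodule ℝ V :=
  cobSpan π Set.univ

/-- The quotient seminorm `‖v + U‖_U = inf_{u ∈ U} ‖v + u‖`. -/
noncomputable def qnorm (U : Set V) (v : V) : ℝ :=
  ⨅ u : U, ‖v + u.1‖

/-- `v` is an additive realization of `φ`: `lim_{F→G} ‖φ(F)/|F| − A_F v‖ = 0`. -/
def IsRealization (π : G →* (V ≃L[ℝ] V)) (φ : FinG G → V) (v : V) : Prop :=
  TendstoG (fun F => ‖(F.1.card : ℝ)⁻¹ • φ F - AF π F.1 v‖) 0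

/-- `φ` is asymptotically additive: `inf_{ψ ∈ M_⊕} |||φ − ψ|||_G = 0`. -/
def AsympAdd (π : G →* (V ≃L[ℝ] V)) (φ : FinG G → V) : Prop :=
  (⨅ ψ : {ψ : FinG G → V // MemM π ψ ∧ IsAdditiveMap ψ}, normG (φ - ψ.1)) = (0 : EReal)

/-- `φ` is asymptotically additive relative to `W`. -/
def AsympAddRel (π : G →* (V ≃L[ℝ] V)) (W : Set V) (φ : FinG G → V) : Prop :=
  (⨅ w : W, limsupG (fun F => ‖(F.1.card : ℝ)⁻¹ • φ F - AF π F.1 w.1‖)) = (0 : EReal)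

/-- The quotient norm on `M_⊕ / N_⊕`. -/
noncomputable def qMplusN (π : G →* (V ≃L[ℝ] V)) (ψ : FinG G → V) : ℝ :=
  ⨅ η : {η : FinG G → V // MemM π η ∧ IsAdditiveMap η ∧ normG η = (0 : EReal)},
    supNorm (ψ + η.1)

end Defs

section QuotientSeminorm

variable {V : Type*} [SeminormedAddCommGroup V]

lemma qnorm_le (S : Set V) (w : V) {u : V} (hu : u ∈ S) : qnorm S w ≤ ‖w + u‖ :=
  ciInf_le ⟨0, by rintro _ ⟨v, rfl⟩; exact norm_nonneg _⟩ (⟨u, hu⟩ : S)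

lemma qnorm_le_of_mem_closure (S : Set V) (w : V) {u : V} (hu : u ∈ closure S) :
    qnorm S w ≤ ‖w + u‖ := by
  have hcl : IsClosed {x : V | qnorm S w ≤ ‖w + x‖} :=
    isClosed_le continuous_const (by fun_prop)
  exact closure_minimal (fun x hx => qnorm_le S w hx) hcl hu

lemma qnorm_nonneg (S : Set V) (w : V) : 0 ≤ qnorm S w :=
  Real.iInf_nonneg fun _ => norm_nonneg _

lemma qnorm_anti {S T : Set V} (hS : S.Nonempty) (h : S ⊆ T) (w : V) :
    qnorm T w ≤ qnorm S w :=
  have := hS.to_subtype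
  le_ciInf fun u => qnorm_le T w (h u.2)

end QuotientSeminorm

section ErgodicAverages

variable {G : Type*} [Group G]
  {V : Type*} [SeminormedAddCommGroup V] [NormedSpace ℝ V]
  {π : G →* (V ≃L[ℝ] V)} {C : ℝ}

lemma AF_add (F : Finset G) (v w : V) : AF π F (v + w) = AF π F v + AF π F w := by
  simp [AF, SF, Finset.sum_add_distrib]

lemma AF_smul (F : Finset G) (c : ℝ) (v : V) : AF π F (c • v) = c • AF π F v := by
  simp [AF, SF, ← Finset.smul_sum, smul_comm c]

lemma AF_zero (F : Finset G) : AF π F (0 : V) = 0 := by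
  simp [AF, SF]

lemma UnifBdd.norm_SF_le (hπ : UnifBdd π C) (F : Finset G) (v : V) :
    ‖SF π F v‖ ≤ F.card * (C * ‖v‖) := by
  simpa [SF] using norm_sum_le_of_le F fun g _ => hπ g⁻¹ v

lemma UnifBdd.norm_AF_le (hπ : UnifBdd π C) {F : Finset G} (hF : F.Nonempty) (v : V) :
    ‖AF π F v‖ ≤ C * ‖v‖ := by
  have hpos : (0 : ℝ) < F.card := by exact_mod_cast hF.card_pos
  rw [AF, norm_smul, Real.norm_of_nonneg (by positivity), inv_mul_le_iff₀ hpos]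
  exact hπ.norm_SF_le F v

lemma sub_rep_mem_cobSpan (W : Set V) (g : G) {w : V} (hw : w ∈ Submodule.span ℝ W) :
    w - π g w ∈ cobSpan π W := by
  induction hw using Submodule.span_induction with
  | mem x hx => exact Submodule.subset_span ⟨x, hx, g, rfl⟩
  | zero => simp
  | add x y _ _ hx hy =>
    rw [map_add, add_sub_add_comm]
    exact add_mem hx hy
  | smul c x _ hx =>
    rw [map_smul, ← smul_sub]
    exact Submodule.smul_mem _ c hx

lemma AF_sub_mem_closure_cobSpan (W : Set V) {F : Finset G} (hF : F.Nonempty) {w : V}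
    (hw : w ∈ closure (Submodule.span ℝ W : Set V)) :
    AF π F w - w ∈ closure (cobSpan π W : Set V) := by
  have hne : (F.card : ℝ) ≠ 0 := by exact_mod_cast hF.card_pos.ne'
  have hg (g : G) : w - π g w ∈ (cobSpan π W).topologicalClosure :=
    map_mem_closure (f := fun x => x - π g x) (by fun_prop) hw
      fun x hx => sub_rep_mem_cobSpan W g hx
  have hsum : AF π F w - w = -((F.card : ℝ)⁻¹ • ∑ g ∈ F, (w - π g⁻¹ w)) := by
    rw [Finset.sum_sub_distrib, Finset.sum_const, ← Nat.cast_smul_eq_nsmul ℝ, smul_sub,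
      inv_smul_smul₀ hne, neg_sub, AF, SF]
  rw [hsum]
  exact neg_mem (Submodule.smul_mem (cobSpan π W).topologicalClosure _
    (sum_mem fun g _ => hg g⁻¹))

variable [DecidableEq G]

lemma SF_apply_rep (F : Finset G) (g : G) (v : V) :
    SF π F (π g v) = SF π (g⁻¹ • F) v := by
  unfold SF
  rw [← Finset.image_smul, Finset.sum_image fun _ _ _ _ h => smul_left_cancel _ h]
  refine Finset.sum_congr rfl fun h _ => ?_
  rw [smul_eq_mul, mul_inv_rev, inv_inv, map_mul]
  rfl

lemma SF_sub_SF (E F : Finset G) (v : V) :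
    SF π E v - SF π F v = SF π (E \ F) v - SF π (F \ E) v := by
  unfold SF
  rw [← Finset.sum_sdiff_sub_sum_sdiff]

/-- Averages of a coboundary over almost invariant sets are small. -/
lemma UnifBdd.exists_norm_AF_le_of_mem_cobSpan (hπ : UnifBdd π C) (hC : 0 ≤ C) {W : Set V}
    {l : V} (hl : l ∈ cobSpan π W) :
    ∃ (K : Finset G) (M : ℝ), 0 ≤ M ∧ ∀ (δ : ℝ) (F : Finset G), 0 ≤ δ → F.Nonempty →
      (∀ k ∈ K, ((k • F \ F).card : ℝ) ≤ δ * F.card) → ‖AF π F l‖ ≤ M * δ := by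
  unfold cobSpan at hl
  induction hl using Submodule.span_induction with
  | mem x hx =>
    obtain ⟨w, -, g, rfl⟩ := hx
    refine ⟨{g⁻¹}, 2 * (C * ‖w‖), by positivity, fun δ F hδ hF hK => ?_⟩
    have hpos : (0 : ℝ) < F.card := by exact_mod_cast hF.card_pos
    have hK := hK g⁻¹ (Finset.mem_singleton_self _)
    have hcard : (F \ g⁻¹ • F).card = (g⁻¹ • F \ F).card :=
      Finset.card_sdiff_comm (by simp)
    have hsub : SF π F (w - π g w) = SF π (F \ g⁻¹ • F) w - SF π (g⁻¹ • F \ F) w := by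
      rw [← SF_sub_SF, ← SF_apply_rep]
      simp [SF, Finset.sum_sub_distrib]
    rw [AF, norm_smul, Real.norm_of_nonneg (by positivity), inv_mul_le_iff₀ hpos, hsub]
    have h₁ := hπ.norm_SF_le (F \ g⁻¹ • F) w
    have h₂ := hπ.norm_SF_le (g⁻¹ • F \ F) w
    rw [hcard] at h₁
    have h₃ := mul_le_mul_of_nonneg_right hK (show 0 ≤ C * ‖w‖ by positivity)
    linarith [norm_sub_le (SF π (F \ g⁻¹ • F) w) (SF π (g⁻¹ • F \ F) w)]
  | zero => exact ⟨∅, 0, le_rfl, fun δ F _ _ _ => by simp [AF_zero]⟩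
  | add x y _ _ hx hy =>
    obtain ⟨K₁, M₁, hM₁, h₁⟩ := hx
    obtain ⟨K₂, M₂, hM₂, h₂⟩ := hy
    refine ⟨K₁ ∪ K₂, M₁ + M₂, by positivity, fun δ F hδ hF hK => ?_⟩
    rw [AF_add, add_mul]
    exact norm_add_le_of_le
      (h₁ δ F hδ hF fun k hk => hK k (Finset.mem_union_left _ hk))
      (h₂ δ F hδ hF fun k hk => hK k (Finset.mem_union_right _ hk))
  | smul c x _ hx =>
    obtain ⟨K, M, hM, h⟩ := hx
    refine ⟨K, ‖c‖ * M, by positivity, fun δ F hδ hF hK => ?_⟩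
    rw [AF_smul, norm_smul, mul_assoc]
    exact mul_le_mul_of_nonneg_left (h δ F hδ hF hK) (norm_nonneg c)

lemma AmenableG.exists_card_smul_sdiff_le (hG : AmenableG G) (K : Finset G) {δ : ℝ}
    (hδ : 0 < δ) :
    ∃ F : Finset G, F.Nonempty ∧ ∀ k ∈ K, ((k • F \ F).card : ℝ) ≤ δ * F.card := by
  obtain ⟨F, hF, hinv⟩ := hG (insert 1 K) (Finset.insert_nonempty 1 K) δ hδ
  refine ⟨F, hF, fun k hk => le_trans ?_ hinv⟩
  have hsub : k • F ⊆ insert 1 K * F :=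
    Finset.smul_finset_subset_mul (Finset.mem_insert_of_mem hk)
  exact_mod_cast Finset.card_le_card
    ((Finset.sdiff_subset_sdiff hsub subset_rfl).trans Finset.subset_union_left)

/-- On `cl(span W)`, the quotient seminorm by any `U ⊇ L_W` is at most `C` times the quotient
seminorm by the weak coboundaries. -/
lemma UnifBdd.qnorm_le_mul_qnorm_closure_cobL (hπ : UnifBdd π C) (hC : 0 ≤ C)
    (hG : AmenableG G) {W : Set V} {U : Set V} (hWU : (cobSpan π W : Set V) ⊆ U)
    {w : V} (hw : w ∈ closure (Submodule.span ℝ W : Set V)) :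
    qnorm U w ≤ C * qnorm (closure (cobL π : Set V)) w := by
  have key : ∀ l ∈ (cobL π : Set V), qnorm U w ≤ C * ‖w + l‖ := by
    intro l hl
    obtain ⟨K, M, hM, hK⟩ := hπ.exists_norm_AF_le_of_mem_cobSpan hC hl
    refine le_of_forall_pos_le_add fun ε hε => ?_
    obtain ⟨F, hF, hFK⟩ := hG.exists_card_smul_sdiff_le K (δ := ε / (M + 1)) (by positivity)
    have h₁ := qnorm_le_of_mem_closure U w
      (closure_mono hWU (AF_sub_mem_closure_cobSpan (π := π) W hF hw))
    rw [add_sub_cancel] at h₁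
    have h₂ := hK _ F (by positivity) hF hFK
    have h₃ : M * (ε / (M + 1)) ≤ ε := by
      rw [mul_div_assoc', div_le_iff₀ (by positivity)]
      nlinarith
    have h₄ := hπ.norm_AF_le hF (w + l)
    have h₅ : ‖AF π F w‖ ≤ ‖AF π F (w + l)‖ + ‖AF π F l‖ := by
      rw [AF_add]
      exact norm_le_add_norm_add _ _
    linarith
  have hcl : IsClosed {l : V | qnorm U w ≤ C * ‖w + l‖} :=
    isClosed_le continuous_const (by fun_prop)
  have : Nonempty (closure (cobL π : Set V)) := ⟨⟨0, subset_closure (zero_mem _)⟩⟩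
  unfold qnorm at *
  rw [Real.mul_iInf_of_nonneg hC]
  exact le_ciInf fun l => closure_minimal key hcl l.2

end ErgodicAverages

theorem statement15 {G : Type*} [Group G] [DecidableEq G] [Countable G]
    {V : Type*} [SeminormedAddCommGroup V] [NormedSpace ℝ V]
    (hG : AmenableG G) (π : G →* (V ≃L[ℝ] V)) (C : ℝ) (hC1 : 1 ≤ C) (hπ : UnifBdd π C)
    (W : Set V) (U : Submodule ℝ V)
    (hWU : (cobSpan π W : Set V) ⊆ (U : Set V))
    (hU : (U : Set V) ⊆ closure (cobL π : Set V)) :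
    -- `θ(w + U) = w + cl(L)` is a linear isomorphism between the images of `cl(span W)`
    -- in `V/U` and in `V/cl(L)`: it is continuous with continuous inverse, i.e. the two
    -- quotient seminorms are equivalent on `cl(span W)` (and `θ` is onto by definition):
    (∀ w ∈ closure ((Submodule.span ℝ W : Submodule ℝ V) : Set V),
      qnorm (closure (cobL π : Set V)) w ≤ C * qnorm (U : Set V) w ∧
      qnorm (U : Set V) w ≤ C * qnorm (closure (cobL π : Set V)) w) ∧
    -- if `π` is isometric then `θ` is an isometry:
    (IsIsometric π →
      ∀ w ∈ closure ((Submodule.span ℝ W : Submodule ℝ V) : Set V),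
        qnorm (U : Set V) w = qnorm (closure (cobL π : Set V)) w) := by
  have hle (w : V) : qnorm (closure (cobL π : Set V)) w ≤ qnorm (U : Set V) w :=
    qnorm_anti ⟨0, zero_mem U⟩ hU w
  refine ⟨fun w hw => ⟨(hle w).trans (le_mul_of_one_le_left (qnorm_nonneg _ w) hC1),
    hπ.qnorm_le_mul_qnorm_closure_cobL (zero_le_one.trans hC1) hG hWU hw⟩,
    fun hiso w hw => le_antisymm ?_ (hle w)⟩
  have hone : UnifBdd π 1 := fun g v => by rw [one_mul, hiso g v]
  simpa using hone.qnorm_le_mul_qnorm_closure_cobL zero_le_one hG hWU hw
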